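/- Let $N\ge 1$, $s\in(0,1)$ and let $\Omega\subsetneq\mathbb R^N$ be a nonempty open set; write $d_\Omega(x)=\operatorname{dist}(x,\partial\Omega)$ for $x\in\Omega$. For measurable $u:\mathbb R^N\to\mathbb R$ let $$[u]_{W^{s,1}(\mathbb R^N)}=\int_{\mathbb R^N}\int_{\mathbb R^N}\frac{|u(x)-u(y)|}{|x-y|^{N+s}}\,dx\,dy\in[0,\infty],$$ and for measurable $E\subseteq\Omega$ let $P_s(E)=[\mathbf 1_E]_{W^{s,1}(\mathbb R^N)}$ and $V_{s,\Omega}(E)=\int_E d_\Omega^{-s}\,dx$. Define $$\mathfrak h_{s,1}(\Omega)=\inf\Big\{[u]_{W^{s,1}(\mathbb R^N)} : u\in C^\infty_c(\Omega),\ \int_\Omega \frac{|u|}{d_\Omega^{s}}\,dx=1\Big\},$$ $$\mathfrak g_s(\Omega)=\inf\Big\{\frac{P_s(E)}{V_{s,\Omega}(E)} : E\subseteq\Omega\ \text{measurable},\ |E|>0,\ V_{s,\Omega}(E)<\infty\Big\}.$$ Then $\mathfrak h_{s,1}(\Omega)=\mathfrak g_s(\Omega)$ as elements of $[0,\infty]$.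 -/

import Mathlib

open MeasureTheory
open scoped ENNReal

/-- The Gagliardo seminorm `[u]_{W^{s,1}(ℝ^N)}`, valued in `[0,∞]`. -/
noncomputable def gagliardo (N : ℕ) (s : ℝ) (u : EuclideanSpace ℝ (Fin N) → ℝ) : ℝ≥0∞ :=
  ∫⁻ x, ∫⁻ y, ENNReal.ofReal (|u x - u y| / dist x y ^ ((N : ℝ) + s))

/-- The distance `d_Ω(x)` of `x` from the boundary of `Ω`. -/
noncomputable def bdryDist {N : ℕ} (Ω : Set (EuclideanSpace ℝ (Fin N)))
    (x : EuclideanSpace ℝ (Fin N)) : ℝ :=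
  Metric.infDist x (frontier Ω)

/-- The sharp fractional Hardy constant `𝔥_{s,1}(Ω)`, an element of `[0,∞]`. -/
noncomputable def hardyConst (N : ℕ) (s : ℝ) (Ω : Set (EuclideanSpace ℝ (Fin N))) : ℝ≥0∞ :=
  sInf { c : ℝ≥0∞ | ∃ u : EuclideanSpace ℝ (Fin N) → ℝ,
    ContDiff ℝ (⊤ : ℕ∞) u ∧ HasCompactSupport u ∧ tsupport u ⊆ Ω ∧
    (∫⁻ x in Ω, ENNReal.ofReal (|u x| / bdryDist Ω x ^ s)) = 1 ∧
    c = gagliardo N s u }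

/-- The `s`-fractional perimeter `P_s(E) = [1_E]_{W^{s,1}(ℝ^N)}`. -/
noncomputable def fracPerimeter (N : ℕ) (s : ℝ) (E : Set (EuclideanSpace ℝ (Fin N))) : ℝ≥0∞ :=
  gagliardo N s (Set.indicator E fun _ => (1 : ℝ))

/-- The weighted volume `V_{s,Ω}(E) = ∫_E d_Ω^{-s}`. -/
noncomputable def weightedVol (N : ℕ) (s : ℝ) (Ω E : Set (EuclideanSpace ℝ (Fin N))) : ℝ≥0∞ :=
  ∫⁻ x in E, ENNReal.ofReal (bdryDist Ω x ^ (-s))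

/-- The Cheeger-type constant `𝔤_s(Ω)` for the fractional perimeter and the weighted volume:
the infimum of `P_s(E) / V_{s,Ω}(E)` over the measurable sets `E ⊆ Ω` of positive Lebesgue measure
and finite weighted volume. For open `Ω`, positive measure gives `0 < V_{s,Ω}(E)`, so every
quotient is by a number in `(0,∞)`. -/
noncomputable def cheegerConst (N : ℕ) (s : ℝ) (Ω : Set (EuclideanSpace ℝ (Fin N))) : ℝ≥0∞ :=
  sInf { c : ℝ≥0∞ | ∃ E : Set (EuclideanSpace ℝ (Fin N)), E ⊆ Ω ∧ MeasurableSet E ∧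
    0 < volume E ∧ weightedVol N s Ω E < ∞ ∧ c = fracPerimeter N s E / weightedVol N s Ω E }

open Set Filter Topology

/-- The weighted integral `∫_Ω |u| / d_Ω^s`. -/
noncomputable def hardyIntegral (N : ℕ) (s : ℝ) (Ω : Set (EuclideanSpace ℝ (Fin N)))
    (u : EuclideanSpace ℝ (Fin N) → ℝ) : ℝ≥0∞ :=
  ∫⁻ x in Ω, ENNReal.ofReal (|u x| / bdryDist Ω x ^ s)

section Basics

variable {N : ℕ} {s : ℝ} {Ω : Set (EuclideanSpace ℝ (Fin N))}

theorem bdryDist_eq_infDist_compl (hop : IsOpen Ω) (hproper : Ω ≠ univ)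
    {x : EuclideanSpace ℝ (Fin N)} (hx : x ∈ Ω) : bdryDist Ω x = Metric.infDist x Ωᶜ := by
  obtain ⟨y, hy, hxy⟩ := exists_mem_frontier_infDist_compl_eq_dist hx hproper
  refine le_antisymm (hxy ▸ Metric.infDist_le_dist_of_mem hy) ?_
  refine Metric.infDist_le_infDist_of_subset ?_ ⟨y, hy⟩
  intro z hz hzΩ
  rw [hop.frontier_eq] at hz
  exact hz.2 hzΩ

theorem infDist_compl_pos (hop : IsOpen Ω) (hproper : Ω ≠ univ)
    {x : EuclideanSpace ℝ (Fin N)} (hx : x ∈ Ω) : 0 < Metric.infDist x Ωᶜ :=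
  (hop.isClosed_compl.notMem_iff_infDist_pos (nonempty_compl.2 hproper)).1 (by simpa using hx)

theorem bdryDist_pos (hop : IsOpen Ω) (hproper : Ω ≠ univ)
    {x : EuclideanSpace ℝ (Fin N)} (hx : x ∈ Ω) : 0 < bdryDist Ω x :=
  bdryDist_eq_infDist_compl hop hproper hx ▸ infDist_compl_pos hop hproper hx

@[fun_prop]
theorem measurable_bdryDist : Measurable (bdryDist Ω) :=
  (Metric.continuous_infDist_pt _).measurable

theorem weightedVol_lt_top_of_isCompact (hop : IsOpen Ω) (hproper : Ω ≠ univ)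
    {K : Set (EuclideanSpace ℝ (Fin N))} (hK : IsCompact K) (hKΩ : K ⊆ Ω) :
    weightedVol N s Ω K < ∞ := by
  have hc : ContinuousOn (fun x => bdryDist Ω x ^ (-s)) K := by
    refine ContinuousOn.rpow_const (Metric.continuous_infDist_pt _).continuousOn ?_
    intro x hx
    exact Or.inl (bdryDist_pos hop hproper (hKΩ hx)).ne'
  exact (hc.integrableOn_compact hK).lintegral_lt_top

theorem weightedVol_mono {E F : Set (EuclideanSpace ℝ (Fin N))} (h : E ⊆ F) :
    weightedVol N s Ω E ≤ weightedVol N s Ω F :=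
  lintegral_mono_set h

theorem weightedVol_pos (hop : IsOpen Ω) (hproper : Ω ≠ univ)
    {E : Set (EuclideanSpace ℝ (Fin N))} (hEΩ : E ⊆ Ω)
    (hpos : 0 < volume E) : 0 < weightedVol N s Ω E := by
  rw [weightedVol, setLIntegral_pos_iff (by fun_prop)]
  refine hpos.trans_le (measure_mono fun x hx => ⟨?_, hx⟩)
  simpa using Real.rpow_pos_of_pos (bdryDist_pos hop hproper (hEΩ hx)) _

theorem hardyIntegral_lt_top (hop : IsOpen Ω) (hproper : Ω ≠ univ)
    {u : EuclideanSpace ℝ (Fin N) → ℝ} (hu : Continuous u) (hc : HasCompactSupport u)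
    (hsub : tsupport u ⊆ Ω) : hardyIntegral N s Ω u < ∞ := by
  have hcont : ContinuousOn (fun x => |u x| / bdryDist Ω x ^ s) (tsupport u) := by
    refine hu.abs.continuousOn.div
      (ContinuousOn.rpow_const (Metric.continuous_infDist_pt _).continuousOn ?_) ?_
    · intro x hx
      exact Or.inl (bdryDist_pos hop hproper (hsub hx)).ne'
    · intro x hx
      exact (Real.rpow_pos_of_pos (bdryDist_pos hop hproper (hsub hx)) _).ne'
  refine lt_of_le_of_lt ?_ (hcont.integrableOn_compact (μ := volume) hc).lintegral_lt_top
  rw [hardyIntegral, ← lintegral_indicator hop.measurableSet,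
    ← lintegral_indicator (isClosed_tsupport u).measurableSet]
  refine lintegral_mono fun x => ?_
  by_cases hx : x ∈ tsupport u
  · simp [hx, hsub hx]
  · have : u x = 0 := image_eq_zero_of_notMem_tsupport hx
    by_cases hxΩ : x ∈ Ω <;> simp [hx, this, hxΩ]

theorem gagliardo_const_mul (c : ℝ) (u : EuclideanSpace ℝ (Fin N) → ℝ) :
    gagliardo N s (fun x => c * u x) = ENNReal.ofReal |c| * gagliardo N s u := by
  have h : ∀ x y, ENNReal.ofReal (|c * u x - c * u y| / dist x y ^ ((N : ℝ) + s)) =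
      ENNReal.ofReal |c| * ENNReal.ofReal (|u x - u y| / dist x y ^ ((N : ℝ) + s)) := by
    intro x y
    rw [← ENNReal.ofReal_mul (abs_nonneg c), ← mul_sub, abs_mul, mul_div_assoc]
  simp_rw [gagliardo, h]
  simp_rw [lintegral_const_mul' _ _ ENNReal.ofReal_ne_top]

theorem hardyIntegral_const_mul (c : ℝ) (u : EuclideanSpace ℝ (Fin N) → ℝ) :
    hardyIntegral N s Ω (fun x => c * u x) = ENNReal.ofReal |c| * hardyIntegral N s Ω u := by
  simp_rw [hardyIntegral, abs_mul, mul_div_assoc, ENNReal.ofReal_mul (abs_nonneg c)]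
  rw [lintegral_const_mul' _ _ ENNReal.ofReal_ne_top]

theorem hardyConst_mul_hardyIntegral_le (hop : IsOpen Ω) (hproper : Ω ≠ univ)
    {u : EuclideanSpace ℝ (Fin N) → ℝ} (hu : ContDiff ℝ (⊤ : ℕ∞) u) (hc : HasCompactSupport u)
    (hsub : tsupport u ⊆ Ω) : hardyConst N s Ω * hardyIntegral N s Ω u ≤ gagliardo N s u := by
  have hfin := hardyIntegral_lt_top (s := s) hop hproper hu.continuous hc hsub
  rcases eq_or_ne (hardyIntegral N s Ω u) 0 with h0 | h0
  · simp [h0]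
  set A := hardyIntegral N s Ω u with hA
  have hinv : ENNReal.ofReal |A.toReal⁻¹| = A⁻¹ := by
    rw [abs_of_nonneg (by positivity), ← ENNReal.toReal_inv,
      ENNReal.ofReal_toReal (ENNReal.inv_ne_top.2 h0)]
  have hle : hardyConst N s Ω ≤ A⁻¹ * gagliardo N s u := by
    refine sInf_le ⟨fun x => A.toReal⁻¹ * u x, contDiff_const.mul hu, hc.mul_left,
      (closure_mono (Function.support_mul_subset_right _ _)).trans hsub, ?_, ?_⟩
    · have := hardyIntegral_const_mul (s := s) (Ω := Ω) A.toReal⁻¹ u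
      rw [hinv, ← hA, ENNReal.inv_mul_cancel h0 hfin.ne] at this
      exact this
    · rw [gagliardo_const_mul, hinv]
  calc hardyConst N s Ω * A ≤ A⁻¹ * gagliardo N s u * A := by gcongr
    _ = gagliardo N s u := by
      rw [mul_comm, ← mul_assoc, ENNReal.mul_inv_cancel h0 hfin.ne, one_mul]

theorem cheegerConst_mul_weightedVol_le (hop : IsOpen Ω) (hproper : Ω ≠ univ)
    {E : Set (EuclideanSpace ℝ (Fin N))} (hE : MeasurableSet E) (hEΩ : E ⊆ Ω)
    (hfin : weightedVol N s Ω E < ∞) :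
    cheegerConst N s Ω * weightedVol N s Ω E ≤ fracPerimeter N s E := by
  rcases eq_or_ne (volume E) 0 with h0 | h0
  · simp [weightedVol, Measure.restrict_eq_zero.2 h0]
  have hpos := weightedVol_pos (s := s) hop hproper hEΩ (pos_iff_ne_zero.2 h0)
  rw [← ENNReal.le_div_iff_mul_le (Or.inl hpos.ne') (Or.inl hfin.ne)]
  exact sInf_le ⟨E, hEΩ, hE, pos_iff_ne_zero.2 h0, hfin, rfl⟩

end Basics

section Coarea

theorem lintegral_Ioi_indicator_lt {a : ℝ} (r : ℝ≥0∞) :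
    ∫⁻ t in Ioi (0 : ℝ), (if t < a then r else 0) = r * ENNReal.ofReal a := by
  have h : (fun t : ℝ => if t < a then r else 0) = (Iio a).indicator fun _ => r := by
    ext t; simp [indicator]
  rw [h, lintegral_indicator measurableSet_Iio, Measure.restrict_restrict measurableSet_Iio,
    lintegral_const, Measure.restrict_apply_univ, inter_comm, Ioi_inter_Iio, Real.volume_Ioo,
    sub_zero]

theorem lintegral_Ioi_abs_indicator_sub {a b : ℝ} (ha : 0 ≤ a) (hb : 0 ≤ b) (r : ℝ) :
    ∫⁻ t in Ioi (0 : ℝ), ENNReal.ofReal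
      (|(if t < a then 1 else 0) - (if t < b then 1 else 0)| / r) =
      ENNReal.ofReal (|a - b| / r) := by
  wlog hab : a ≤ b generalizing a b with H
  · rw [abs_sub_comm a b, ← H hb ha (le_of_not_ge hab)]
    simp_rw [abs_sub_comm]
  have h : ∀ t : ℝ, ENNReal.ofReal
      (|(if t < a then (1 : ℝ) else 0) - (if t < b then 1 else 0)| / r) =
      (Ico a b).indicator (fun _ => ENNReal.ofReal (1 / r)) t := by
    intro t
    by_cases h1 : t < a
    · have h2 : t < b := h1.trans_le hab
      simp [h1, h2, h1.not_ge]
    · by_cases h2 : t < b <;> simp [h1, h2, not_lt.1 h1]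
  simp_rw [h]
  rw [lintegral_indicator measurableSet_Ico, Measure.restrict_restrict measurableSet_Ico,
    lintegral_const, Measure.restrict_apply_univ]
  have hvol : volume (Ico a b ∩ Ioi 0) = ENNReal.ofReal (b - a) := by
    refine le_antisymm ((measure_mono inter_subset_left).trans_eq Real.volume_Ico) ?_
    rw [← Real.volume_Ioo]
    exact measure_mono fun t ht => ⟨⟨ht.1.le, ht.2⟩, ha.trans_lt ht.1⟩
  rw [hvol, ← ENNReal.ofReal_mul' (by linarith), abs_sub_comm, abs_of_nonneg (by linarith)]
  congr 1; ring

variable {N : ℕ} {s : ℝ} {Ω : Set (EuclideanSpace ℝ (Fin N))}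

theorem gagliardo_eq_lintegral_fracPerimeter {u : EuclideanSpace ℝ (Fin N) → ℝ}
    (hu : Measurable u) (hnn : ∀ x, 0 ≤ u x) :
    gagliardo N s u = ∫⁻ t in Ioi (0 : ℝ), fracPerimeter N s {x | t < u x} := by
  let f : EuclideanSpace ℝ (Fin N) → EuclideanSpace ℝ (Fin N) → ℝ → ℝ≥0∞ := fun x y t =>
    ENNReal.ofReal (|(if t < u x then 1 else 0) - (if t < u y then 1 else 0)| /
      dist x y ^ ((N : ℝ) + s))
  have hf : Measurable fun p : (EuclideanSpace ℝ (Fin N) × ℝ) × EuclideanSpace ℝ (Fin N) =>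
      f p.1.1 p.2 p.1.2 := by
    refine ENNReal.measurable_ofReal.comp (Measurable.div (Measurable.abs (Measurable.sub ?_ ?_))
      (by fun_prop))
    · exact Measurable.ite (measurableSet_lt (by fun_prop) (by fun_prop)) (by fun_prop)
        (by fun_prop)
    · exact Measurable.ite (measurableSet_lt (by fun_prop) (by fun_prop)) (by fun_prop)
        (by fun_prop)
  have h1 : gagliardo N s u = ∫⁻ x, ∫⁻ y, ∫⁻ t in Ioi (0 : ℝ), f x y t := by
    simp_rw [gagliardo, f, lintegral_Ioi_abs_indicator_sub (hnn _) (hnn _)]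
  have h2 : ∀ x, ∫⁻ y, ∫⁻ t in Ioi (0 : ℝ), f x y t = ∫⁻ t in Ioi (0 : ℝ), ∫⁻ y, f x y t := by
    intro x
    refine lintegral_lintegral_swap (Measurable.aemeasurable ?_)
    exact hf.comp (f := fun p : EuclideanSpace ℝ (Fin N) × ℝ => ((x, p.2), p.1)) (by fun_prop)
  simp_rw [h1, h2]
  rw [lintegral_lintegral_swap]
  · refine lintegral_congr fun t => ?_
    simp [fracPerimeter, gagliardo, f, indicator]
  · exact hf.lintegral_prod_right'.aemeasurable

theorem hardyIntegral_eq_lintegral_weightedVol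
    {u : EuclideanSpace ℝ (Fin N) → ℝ}
    (hu : Measurable u) (hsub : Function.support u ⊆ Ω) :
    hardyIntegral N s Ω u = ∫⁻ t in Ioi (0 : ℝ), weightedVol N s Ω {x | t < |u x|} := by
  have h1 : hardyIntegral N s Ω u = ∫⁻ x in Ω, ∫⁻ t in Ioi (0 : ℝ),
      (if t < |u x| then ENNReal.ofReal (bdryDist Ω x ^ (-s)) else 0) := by
    simp_rw [lintegral_Ioi_indicator_lt]
    refine lintegral_congr fun x => ?_
    have hd : 0 ≤ bdryDist Ω x := Metric.infDist_nonneg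
    rw [← ENNReal.ofReal_mul (by positivity), Real.rpow_neg hd, div_eq_inv_mul]
  rw [h1, lintegral_lintegral_swap]
  · refine setLIntegral_congr_fun measurableSet_Ioi fun t ht => ?_
    have hm : MeasurableSet {x | t < |u x|} := measurableSet_lt (by fun_prop) (by fun_prop)
    have hi : (fun x => if t < |u x| then ENNReal.ofReal (bdryDist Ω x ^ (-s)) else 0) =
        {x | t < |u x|}.indicator fun x => ENNReal.ofReal (bdryDist Ω x ^ (-s)) := by
      ext x; simp [indicator]
    simp only [hi]
    rw [lintegral_indicator hm, Measure.restrict_restrict hm, weightedVol,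
      inter_eq_left.2]
    intro x (hx : t < |u x|)
    exact hsub (abs_pos.1 (lt_trans ht hx))
  · refine Measurable.aemeasurable (Measurable.ite ?_ (by fun_prop) (by fun_prop))
    exact measurableSet_lt (by fun_prop) (by fun_prop)

theorem gagliardo_abs_le (u : EuclideanSpace ℝ (Fin N) → ℝ) :
    gagliardo N s (fun x => |u x|) ≤ gagliardo N s u := by
  refine lintegral_mono fun x => lintegral_mono fun y => ENNReal.ofReal_le_ofReal ?_
  exact div_le_div_of_nonneg_right (abs_abs_sub_abs_le (u x) (u y)) (by positivity)

theorem cheegerConst_le_hardyConst (hop : IsOpen Ω) (hproper : Ω ≠ univ) :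
    cheegerConst N s Ω ≤ hardyConst N s Ω := by
  refine le_sInf ?_
  rintro _ ⟨u, hu, hc, hsub, h1, rfl⟩
  have hum : Measurable u := hu.continuous.measurable
  calc cheegerConst N s Ω = cheegerConst N s Ω * hardyIntegral N s Ω u := by
        rw [hardyIntegral, h1, mul_one]
    _ ≤ ∫⁻ t in Ioi (0 : ℝ), cheegerConst N s Ω * weightedVol N s Ω {x | t < |u x|} := by
        rw [hardyIntegral_eq_lintegral_weightedVol hum ((subset_tsupport u).trans hsub)]
        refine (lintegral_const_mul _ ?_).ge
        have : Antitone fun t : ℝ => weightedVol N s Ω {x | t < |u x|} := fun a b hab =>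
          weightedVol_mono fun x (hx : b < |u x|) => hab.trans_lt hx
        exact this.measurable
    _ ≤ ∫⁻ t in Ioi (0 : ℝ), fracPerimeter N s {x | t < |u x|} := by
        refine setLIntegral_mono' measurableSet_Ioi fun t ht => ?_
        have hK : {x | t < |u x|} ⊆ tsupport u := fun x (hx : t < |u x|) =>
          subset_tsupport u (abs_pos.1 (lt_trans ht hx))
        refine cheegerConst_mul_weightedVol_le hop hproper
          (measurableSet_lt (by fun_prop) (by fun_prop)) (hK.trans hsub) ?_
        exact (weightedVol_mono hK).trans_lt (weightedVol_lt_top_of_isCompact hop hproper hc hsub)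
    _ = gagliardo N s fun x => |u x| :=
        (gagliardo_eq_lintegral_fracPerimeter hum.abs fun x => abs_nonneg _).symm
    _ ≤ gagliardo N s u := gagliardo_abs_le u

end Coarea

section Kernel

theorem integrable_min_one_norm_div_rpow {N : ℕ} (hN : 1 ≤ N) {s : ℝ} (hs : s ∈ Ioo (0 : ℝ) 1) :
    Integrable fun z : EuclideanSpace ℝ (Fin N) => min 1 (2 * ‖z‖) / ‖z‖ ^ ((N : ℝ) + s) := by
  obtain ⟨hs0, hs1⟩ := hs
  have : Nonempty (Fin N) := ⟨⟨0, hN⟩⟩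
  rw [integrable_fun_norm_addHaar volume (f := fun r : ℝ => min 1 (2 * r) / r ^ ((N : ℝ) + s)),
    finrank_euclideanSpace_fin]
  have key : ∀ r : ℝ, 0 < r → r ^ (N - 1) • (min 1 (2 * r) / r ^ ((N : ℝ) + s)) =
      min 1 (2 * r) * r ^ (-1 - s) := by
    intro r hr
    have : r ^ (N - 1) = r ^ ((N : ℝ) - 1) := by
      rw [← Real.rpow_natCast, Nat.cast_sub hN, Nat.cast_one]
    rw [this, smul_eq_mul, div_eq_mul_inv, ← Real.rpow_neg hr.le, mul_left_comm, ← Real.rpow_add hr]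
    congr 2; ring
  have hmeas : Measurable fun r : ℝ => r ^ (N - 1) • (min 1 (2 * r) / r ^ ((N : ℝ) + s)) := by
    fun_prop
  rw [← Ioc_union_Ioi_eq_Ioi zero_le_one]
  refine IntegrableOn.union ?_ ?_
  · have hi : IntegrableOn (fun r : ℝ => 2 * r ^ (-s)) (Ioc 0 1) := by
      rw [← intervalIntegrable_iff_integrableOn_Ioc_of_le zero_le_one]
      exact (intervalIntegral.intervalIntegrable_rpow' (by linarith)).const_mul 2
    refine Integrable.mono' hi hmeas.aestronglyMeasurable ?_
    refine (ae_restrict_iff' measurableSet_Ioc).2 (.of_forall fun r hr => ?_)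
    have h0 : 0 ≤ min 1 (2 * r) := le_min zero_le_one (by linarith [hr.1])
    have hp : 0 ≤ r ^ (-1 - s) := Real.rpow_nonneg hr.1.le _
    rw [key r hr.1, Real.norm_of_nonneg (mul_nonneg h0 hp)]
    calc min 1 (2 * r) * r ^ (-1 - s) ≤ 2 * r * r ^ (-1 - s) := by
          gcongr; exact min_le_right _ _
      _ = 2 * (r ^ (1 : ℝ) * r ^ (-1 - s)) := by rw [Real.rpow_one]; ring
      _ = 2 * r ^ (-s) := by rw [← Real.rpow_add hr.1]; congr 2; ring
  · have hi : IntegrableOn (fun r : ℝ => r ^ (-1 - s)) (Ioi 1) :=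
      integrableOn_Ioi_rpow_of_lt (by linarith) zero_lt_one
    refine Integrable.mono' hi hmeas.aestronglyMeasurable ?_
    refine (ae_restrict_iff' measurableSet_Ioi).2 (.of_forall fun r (hr : 1 < r) => ?_)
    have hr0 : 0 < r := by linarith
    have h0 : 0 ≤ min 1 (2 * r) := le_min zero_le_one (by linarith)
    have hp : 0 ≤ r ^ (-1 - s) := Real.rpow_nonneg hr0.le _
    rw [key r hr0, Real.norm_of_nonneg (mul_nonneg h0 hp)]
    exact mul_le_of_le_one_left hp (min_le_left _ _)

theorem lintegral_comp_const_smul {N : ℕ} (F : EuclideanSpace ℝ (Fin N) → ℝ≥0∞)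
    (hF : Measurable F) {r : ℝ} (hr : 0 < r) :
    ∫⁻ z, F (r • z) = ENNReal.ofReal ((r ^ N)⁻¹) * ∫⁻ z, F z := by
  rw [← lintegral_map hF (measurable_const_smul r), Measure.map_addHaar_smul _ hr.ne',
    lintegral_smul_measure, finrank_euclideanSpace_fin, abs_of_pos (by positivity), smul_eq_mul]

theorem lintegral_min_one_dist_div_rpow {N : ℕ} {s δ : ℝ} (hδ : 0 < δ)
    (x : EuclideanSpace ℝ (Fin N)) :
    ∫⁻ y, ENNReal.ofReal (min 1 (2 * (dist x y / δ)) / dist x y ^ ((N : ℝ) + s)) =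
      ENNReal.ofReal (δ ^ (-s)) * ∫⁻ z : EuclideanSpace ℝ (Fin N),
        ENNReal.ofReal (min 1 (2 * ‖z‖) / ‖z‖ ^ ((N : ℝ) + s)) := by
  set F : EuclideanSpace ℝ (Fin N) → ℝ≥0∞ := fun z =>
    ENNReal.ofReal (min 1 (2 * ‖z‖) / ‖z‖ ^ ((N : ℝ) + s)) with hFdef
  have hF : Measurable F := by fun_prop
  have h1 : ∀ y, ENNReal.ofReal (min 1 (2 * (dist x y / δ)) / dist x y ^ ((N : ℝ) + s)) =
      (fun z => ENNReal.ofReal (δ ^ (-((N : ℝ) + s))) * F (δ⁻¹ • z)) (y - x) := by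
    intro y
    simp only [hFdef]
    rw [← ENNReal.ofReal_mul (by positivity), norm_smul, Real.norm_of_nonneg (by positivity),
      dist_comm, dist_eq_norm, Real.mul_rpow (by positivity) (norm_nonneg _),
      Real.rpow_neg hδ.le, Real.inv_rpow hδ.le]
    congr 1
    have : δ ^ ((N : ℝ) + s) ≠ 0 := (Real.rpow_pos_of_pos hδ _).ne'
    rw [div_eq_inv_mul ‖y - x‖]
    rw [div_eq_mul_inv, div_eq_mul_inv, mul_inv, inv_inv]
    field_simp
  simp_rw [h1]
  rw [lintegral_sub_right_eq_self
    (fun z => ENNReal.ofReal (δ ^ (-((N : ℝ) + s))) * F (δ⁻¹ • z)) x,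
    lintegral_const_mul' _ _ ENNReal.ofReal_ne_top,
    lintegral_comp_const_smul F hF (inv_pos.2 hδ), ← mul_assoc,
    ← ENNReal.ofReal_mul (by positivity)]
  congr 2
  rw [inv_pow, inv_inv, ← Real.rpow_natCast, ← Real.rpow_add hδ]
  congr 1; ring

end Kernel

section Cutoff

/-- The piecewise linear transition equal to `0` on `(-∞, 1]` and to `1` on `[2, ∞)`. -/
noncomputable def ramp (t : ℝ) : ℝ := max 0 (min 1 (t - 1))

theorem ramp_nonneg (t : ℝ) : 0 ≤ ramp t := le_max_left _ _

theorem ramp_le_one (t : ℝ) : ramp t ≤ 1 := max_le zero_le_one (min_le_left _ _)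

theorem ramp_of_two_le {t : ℝ} (h : 2 ≤ t) : ramp t = 1 := by
  rw [ramp, min_eq_left (by linarith), max_eq_right zero_le_one]

theorem ramp_of_le_one {t : ℝ} (h : t ≤ 1) : ramp t = 0 := by
  rw [ramp, max_eq_left ((min_le_right _ _).trans (by linarith))]

@[fun_prop]
theorem continuous_ramp : Continuous ramp := by unfold ramp; fun_prop

theorem abs_ramp_sub_ramp_le (a b : ℝ) : |ramp a - ramp b| ≤ |a - b| := by
  unfold ramp
  grind

theorem abs_ramp_sub_mul_le {a b : ℝ} (ha : 0 ≤ a) (hb : 0 ≤ b) :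
    |ramp a - ramp b| * b ≤ 2 * |a - b| := by
  rcases le_total b 2 with h2 | h2
  · calc |ramp a - ramp b| * b ≤ |a - b| * 2 :=
          mul_le_mul (abs_ramp_sub_ramp_le a b) h2 hb (abs_nonneg _)
      _ = 2 * |a - b| := mul_comm _ _
  · rw [ramp_of_two_le h2, abs_sub_comm, abs_of_nonneg (sub_nonneg.2 (ramp_le_one a))]
    rcases le_total a 1 with h | h
    · rw [ramp_of_le_one h, abs_sub_comm, abs_of_nonneg (by linarith)]; linarith
    · rcases le_total 2 a with h' | h'
      · rw [ramp_of_two_le h', sub_self, zero_mul]; positivity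
      · have : ramp a = a - 1 := by
          rw [ramp, min_eq_right (by linarith), max_eq_right (by linarith)]
        rw [this, abs_sub_comm, abs_of_nonneg (by linarith)]
        nlinarith

/-- Rescaled ramps vary slowly relative to their argument. -/
theorem abs_ramp_const_mul_sub_le {l a b D δ : ℝ} (hl : 0 < l) (ha : 0 ≤ a) (hδ : 0 < δ)
    (hδb : δ ≤ b) (hab : |a - b| ≤ D) :
    |ramp (l * a) - ramp (l * b)| ≤ 2 * (D / δ) := by
  have hb : 0 < b := hδ.trans_le hδb
  have h := abs_ramp_sub_mul_le (mul_nonneg hl.le ha) (mul_nonneg hl.le hb.le)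
  rw [← mul_sub, abs_mul, abs_of_pos hl] at h
  have h' : |ramp (l * a) - ramp (l * b)| * b ≤ 2 * |a - b| := by
    refine le_of_mul_le_mul_left ?_ hl
    linarith
  rw [← mul_div_assoc, le_div_iff₀ hδ]
  calc |ramp (l * a) - ramp (l * b)| * δ ≤ |ramp (l * a) - ramp (l * b)| * b := by gcongr
    _ ≤ 2 * |a - b| := h'
    _ ≤ 2 * D := by gcongr

variable {N : ℕ} {s : ℝ} {Ω : Set (EuclideanSpace ℝ (Fin N))}

/-- The cutoff that vanishes where the distance to `Ωᶜ` is at most `1 / (n + 1)` or the distance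
to `x₀` is at least `2 (n + 1)`. -/
noncomputable def domainCutoff (Ω : Set (EuclideanSpace ℝ (Fin N)))
    (x₀ : EuclideanSpace ℝ (Fin N)) (n : ℕ) (x : EuclideanSpace ℝ (Fin N)) : ℝ :=
  min (ramp ((n + 1 : ℝ) * Metric.infDist x Ωᶜ)) (1 - ramp ((n + 1 : ℝ)⁻¹ * dist x x₀))

theorem domainCutoff_nonneg (x₀ : EuclideanSpace ℝ (Fin N)) (n : ℕ)
    (x : EuclideanSpace ℝ (Fin N)) : 0 ≤ domainCutoff Ω x₀ n x :=
  le_min (ramp_nonneg _) (sub_nonneg.2 (ramp_le_one _))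

theorem domainCutoff_le_one (x₀ : EuclideanSpace ℝ (Fin N)) (n : ℕ)
    (x : EuclideanSpace ℝ (Fin N)) : domainCutoff Ω x₀ n x ≤ 1 :=
  (min_le_left _ _).trans (ramp_le_one _)

@[fun_prop]
theorem continuous_domainCutoff (x₀ : EuclideanSpace ℝ (Fin N)) (n : ℕ) :
    Continuous (domainCutoff Ω x₀ n) := by
  have := Metric.continuous_infDist_pt Ωᶜ
  unfold domainCutoff
  fun_prop

theorem abs_domainCutoff_sub_le {x₀ x y : EuclideanSpace ℝ (Fin N)} (hx₀ : x₀ ∉ Ω) (n : ℕ)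
    (hx : 0 < Metric.infDist x Ωᶜ) :
    |domainCutoff Ω x₀ n x - domainCutoff Ω x₀ n y| ≤
      min 1 (2 * (dist x y / Metric.infDist x Ωᶜ)) := by
  refine le_min ?_ ?_
  · have h1 := domainCutoff_nonneg (Ω := Ω) x₀ n x
    have h2 := domainCutoff_nonneg (Ω := Ω) x₀ n y
    have h3 := domainCutoff_le_one (Ω := Ω) x₀ n x
    have h4 := domainCutoff_le_one (Ω := Ω) x₀ n y
    rw [abs_le]; constructor <;> linarith
  · rw [abs_sub_comm]
    refine (abs_min_sub_min_le_max _ _ _ _).trans (max_le ?_ ?_)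
    · refine abs_ramp_const_mul_sub_le (by positivity) Metric.infDist_nonneg hx le_rfl ?_
      rw [dist_comm]
      have h := (Metric.lipschitz_infDist_pt Ωᶜ).dist_le_mul y x
      rwa [NNReal.coe_one, one_mul, Real.dist_eq] at h
    · rw [sub_sub_sub_cancel_left, abs_sub_comm]
      refine abs_ramp_const_mul_sub_le (by positivity) dist_nonneg hx
        (Metric.infDist_le_dist_of_mem hx₀) ?_
      rw [dist_comm x y]
      exact abs_dist_sub_le y x x₀

theorem tendsto_domainCutoff (hop : IsOpen Ω) (hproper : Ω ≠ univ)
    {x₀ x : EuclideanSpace ℝ (Fin N)} (hx : x ∈ Ω) :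
    Tendsto (fun n => domainCutoff Ω x₀ n x) atTop (𝓝 1) := by
  have hd := infDist_compl_pos hop hproper hx
  refine tendsto_const_nhds.congr' ?_
  have ht : Tendsto (fun n : ℕ => (n + 1 : ℝ)) atTop atTop :=
    tendsto_atTop_add_const_right _ _ tendsto_natCast_atTop_atTop
  filter_upwards [(ht.atTop_mul_const hd).eventually_ge_atTop 2,
    ht.eventually_ge_atTop (dist x x₀)] with n h1 h2
  have h3 : (n + 1 : ℝ)⁻¹ * dist x x₀ ≤ 1 := by
    rw [inv_mul_le_iff₀ (by positivity), mul_one]; exact h2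
  rw [domainCutoff, ramp_of_two_le h1, ramp_of_le_one h3, sub_zero, min_self]

theorem hasCompactSupport_domainCutoff (x₀ : EuclideanSpace ℝ (Fin N)) (n : ℕ) :
    HasCompactSupport (domainCutoff Ω x₀ n) := by
  refine HasCompactSupport.of_support_subset_isCompact
    (isCompact_closedBall x₀ (2 * (n + 1 : ℝ))) fun x hx => ?_
  by_contra h
  rw [Metric.mem_closedBall, not_le] at h
  refine hx ?_
  have h2 : 2 ≤ (n + 1 : ℝ)⁻¹ * dist x x₀ := by
    rw [le_inv_mul_iff₀ (by positivity)]; linarith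
  rw [domainCutoff, ramp_of_two_le h2, sub_self, min_eq_right (ramp_nonneg _)]

theorem tsupport_domainCutoff_subset (x₀ : EuclideanSpace ℝ (Fin N)) (n : ℕ) :
    tsupport (domainCutoff Ω x₀ n) ⊆ Ω := by
  have hcl : IsClosed {x | 1 ≤ (n + 1 : ℝ) * Metric.infDist x Ωᶜ} :=
    isClosed_le continuous_const (continuous_const.mul (Metric.continuous_infDist_pt _))
  have h1 : tsupport (domainCutoff Ω x₀ n) ⊆ {x | 1 ≤ (n + 1 : ℝ) * Metric.infDist x Ωᶜ} := by
    refine closure_minimal (fun x hx => ?_) hcl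
    by_contra h
    refine hx ?_
    rw [domainCutoff, ramp_of_le_one (not_le.1 h).le, min_eq_left (sub_nonneg.2 (ramp_le_one _))]
  intro x hx
  by_contra h
  have := h1 hx
  rw [mem_ofPred_eq, Metric.infDist_zero_of_mem (show x ∈ Ωᶜ from h)] at this
  linarith

theorem gagliardo_eq_lintegral_prod {u : EuclideanSpace ℝ (Fin N) → ℝ} (hu : Measurable u) :
    gagliardo N s u = ∫⁻ p : EuclideanSpace ℝ (Fin N) × EuclideanSpace ℝ (Fin N),
      ENNReal.ofReal (|u p.1 - u p.2| / dist p.1 p.2 ^ ((N : ℝ) + s)) := by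
  rw [Measure.volume_eq_prod, lintegral_prod _ (by fun_prop)]
  rfl

theorem tendsto_gagliardo_mul_domainCutoff (hN : 1 ≤ N) (hs : s ∈ Ioo (0 : ℝ) 1) (hop : IsOpen Ω)
    (hproper : Ω ≠ univ) {x₀ : EuclideanSpace ℝ (Fin N)} (hx₀ : x₀ ∉ Ω)
    {u : EuclideanSpace ℝ (Fin N) → ℝ} (hu : Measurable u) (hsupp : ∀ x ∉ Ω, u x = 0)
    (hG : gagliardo N s u ≠ ∞) (hV : hardyIntegral N s Ω u ≠ ∞) :
    Tendsto (fun n => gagliardo N s fun x => u x * domainCutoff Ω x₀ n x) atTop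
      (𝓝 (gagliardo N s u)) := by
  have hη : ∀ n, Measurable (domainCutoff Ω x₀ n) := fun n =>
    (continuous_domainCutoff x₀ n).measurable
  have hdm : Measurable fun x : EuclideanSpace ℝ (Fin N) => Metric.infDist x Ωᶜ :=
    (Metric.continuous_infDist_pt _).measurable
  set C : ℝ≥0∞ := ∫⁻ z : EuclideanSpace ℝ (Fin N),
    ENNReal.ofReal (min 1 (2 * ‖z‖) / ‖z‖ ^ ((N : ℝ) + s)) with hC
  have hCfin : C ≠ ∞ := (integrable_min_one_norm_div_rpow hN hs).lintegral_lt_top.ne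
  let k : EuclideanSpace ℝ (Fin N) × EuclideanSpace ℝ (Fin N) → ℝ≥0∞ := fun p =>
    ENNReal.ofReal |u p.1| * ENNReal.ofReal
      (min 1 (2 * (dist p.1 p.2 / Metric.infDist p.1 Ωᶜ)) / dist p.1 p.2 ^ ((N : ℝ) + s))
  have hk : Measurable k := by
    have : Measurable fun p : EuclideanSpace ℝ (Fin N) × EuclideanSpace ℝ (Fin N) =>
      Metric.infDist p.1 Ωᶜ := hdm.comp measurable_fst
    fun_prop
  have hkfin : ∫⁻ p, k p ≠ ∞ := by
    rw [Measure.volume_eq_prod, lintegral_prod _ hk.aemeasurable]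
    have hle : ∫⁻ x, ∫⁻ y, k (x, y) ≤ C * hardyIntegral N s Ω u := by
      rw [hardyIntegral, ← lintegral_indicator hop.measurableSet, ← lintegral_const_mul' _ _ hCfin]
      refine lintegral_mono fun x => ?_
      simp only [k]
      rw [lintegral_const_mul' _ _ ENNReal.ofReal_ne_top]
      by_cases hx : x ∈ Ω
      · rw [lintegral_min_one_dist_div_rpow (infDist_compl_pos hop hproper hx),
          indicator_of_mem hx, bdryDist_eq_infDist_compl hop hproper hx, div_eq_mul_inv,
          ← Real.rpow_neg Metric.infDist_nonneg, ENNReal.ofReal_mul (abs_nonneg _), ← mul_assoc,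
          mul_comm]
      · simp [hsupp x hx]
    exact (hle.trans_lt (ENNReal.mul_lt_top hCfin.lt_top hV.lt_top)).ne
  have hprod : ∀ n, (gagliardo N s fun x => u x * domainCutoff Ω x₀ n x) = _ := fun n =>
    gagliardo_eq_lintegral_prod (hu.mul (hη n))
  simp_rw [hprod, gagliardo_eq_lintegral_prod hu]
  rw [gagliardo_eq_lintegral_prod hu] at hG
  refine tendsto_lintegral_of_dominated_convergence (fun p =>
    ENNReal.ofReal (|u p.1 - u p.2| / dist p.1 p.2 ^ ((N : ℝ) + s)) + k p) (fun n => ?_)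
    (fun n => ?_) ?_ ?_
  · have := hη n
    fun_prop
  · refine .of_forall fun p => ?_
    have hη0 := domainCutoff_nonneg (Ω := Ω) x₀ n p.2
    have hη1 := domainCutoff_le_one (Ω := Ω) x₀ n p.2
    simp only [k]
    have hd : 0 ≤ Metric.infDist p.1 Ωᶜ := Metric.infDist_nonneg
    rw [← ENNReal.ofReal_mul (abs_nonneg _), ← ENNReal.ofReal_add (by positivity) (by positivity),
      ← mul_div_assoc, ← add_div]
    refine ENNReal.ofReal_le_ofReal (div_le_div_of_nonneg_right ?_ (by positivity))
    have hsplit : u p.1 * domainCutoff Ω x₀ n p.1 - u p.2 * domainCutoff Ω x₀ n p.2 =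
        (u p.1 - u p.2) * domainCutoff Ω x₀ n p.2 +
          u p.1 * (domainCutoff Ω x₀ n p.1 - domainCutoff Ω x₀ n p.2) := by ring
    simp only [hsplit]
    refine (abs_add_le _ _).trans (add_le_add ?_ ?_)
    · rw [abs_mul, abs_of_nonneg hη0]
      exact mul_le_of_le_one_right (abs_nonneg _) hη1
    · rw [abs_mul]
      by_cases hp : p.1 ∈ Ω
      · exact mul_le_mul_of_nonneg_left
          (abs_domainCutoff_sub_le hx₀ n (infDist_compl_pos hop hproper hp)) (abs_nonneg _)
      · simp [hsupp _ hp]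
  · rw [lintegral_add_right _ hk]
    exact ENNReal.add_ne_top.2 ⟨hG, hkfin⟩
  · refine .of_forall fun p => ENNReal.tendsto_ofReal (Tendsto.div_const (Tendsto.abs ?_) _)
    have hlim : ∀ x, Tendsto (fun n => u x * domainCutoff Ω x₀ n x) atTop (𝓝 (u x)) := by
      intro x
      by_cases hx : x ∈ Ω
      · simpa using (tendsto_domainCutoff hop hproper hx).const_mul (u x)
      · simp [hsupp x hx]
    exact (hlim p.1).sub (hlim p.2)

end Cutoff

section Mollification

open scoped Convolution NNReal

variable {N : ℕ} {s : ℝ} {Ω : Set (EuclideanSpace ℝ (Fin N))}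

theorem gagliardo_comp_sub_right (v : EuclideanSpace ℝ (Fin N) → ℝ)
    (z : EuclideanSpace ℝ (Fin N)) : (gagliardo N s fun x => v (x - z)) = gagliardo N s v := by
  let g : EuclideanSpace ℝ (Fin N) → EuclideanSpace ℝ (Fin N) → ℝ≥0∞ := fun x y =>
    ENNReal.ofReal (|v x - v y| / dist x y ^ ((N : ℝ) + s))
  have h : (gagliardo N s fun x => v (x - z)) = ∫⁻ x, ∫⁻ y, g (x - z) (y - z) := by
    simp [gagliardo, g]
  rw [h]
  have hy : ∀ x, ∫⁻ y, g (x - z) (y - z) = ∫⁻ y, g (x - z) y := fun x =>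
    lintegral_sub_right_eq_self (g (x - z)) z
  simp_rw [hy]
  exact lintegral_sub_right_eq_self (fun x => ∫⁻ y, g x y) z

theorem gagliardo_convolution_le {ρ v : EuclideanSpace ℝ (Fin N) → ℝ} (hρ : Measurable ρ)
    (hρ0 : ∀ z, 0 ≤ ρ z) (hρ1 : ∫⁻ z, ENNReal.ofReal (ρ z) = 1) (hv : Measurable v)
    (hint : ConvolutionExists ρ v (ContinuousLinearMap.lsmul ℝ ℝ) volume) :
    gagliardo N s (ρ ⋆[ContinuousLinearMap.lsmul ℝ ℝ, volume] v) ≤ gagliardo N s v := by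
  let f : EuclideanSpace ℝ (Fin N) → EuclideanSpace ℝ (Fin N) → EuclideanSpace ℝ (Fin N) →
      ℝ≥0∞ := fun x y z =>
    ENNReal.ofReal (ρ z) *
      ENNReal.ofReal (|v (x - z) - v (y - z)| / dist x y ^ ((N : ℝ) + s))
  have hf : Measurable fun p : (EuclideanSpace ℝ (Fin N) × EuclideanSpace ℝ (Fin N)) ×
      EuclideanSpace ℝ (Fin N) => f p.1.1 p.2 p.1.2 := by
    simp only [f]
    fun_prop
  have hpt : ∀ x y, ENNReal.ofReal (|(ρ ⋆[ContinuousLinearMap.lsmul ℝ ℝ, volume] v) x -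
      (ρ ⋆[ContinuousLinearMap.lsmul ℝ ℝ, volume] v) y| / dist x y ^ ((N : ℝ) + s)) ≤
      ∫⁻ z, f x y z := by
    intro x y
    rw [convolution_def, convolution_def, ← integral_sub (hint x) (hint y), div_eq_mul_inv,
      ENNReal.ofReal_mul (abs_nonneg _), ← Real.enorm_eq_ofReal_abs]
    refine (mul_le_mul_left (enorm_integral_le_lintegral_enorm _) _).trans_eq ?_
    rw [← lintegral_mul_const' _ _ ENNReal.ofReal_ne_top]
    refine lintegral_congr fun z => ?_
    simp only [f, ContinuousLinearMap.lsmul_apply, smul_eq_mul]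
    rw [← mul_sub, Real.enorm_eq_ofReal_abs, abs_mul, abs_of_nonneg (hρ0 z),
      ENNReal.ofReal_mul (hρ0 z), mul_assoc, ← ENNReal.ofReal_mul (abs_nonneg _), div_eq_mul_inv]
  calc gagliardo N s (ρ ⋆[ContinuousLinearMap.lsmul ℝ ℝ, volume] v)
      ≤ ∫⁻ x, ∫⁻ y, ∫⁻ z, f x y z := lintegral_mono fun x => lintegral_mono fun y => hpt x y
    _ = ∫⁻ x, ∫⁻ z, ∫⁻ y, f x y z := by
        refine lintegral_congr fun x => lintegral_lintegral_swap (Measurable.aemeasurable ?_)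
        exact hf.comp (f := fun p : EuclideanSpace ℝ (Fin N) × EuclideanSpace ℝ (Fin N) =>
          ((x, p.2), p.1)) (by fun_prop)
    _ = ∫⁻ z, ∫⁻ x, ∫⁻ y, f x y z :=
        lintegral_lintegral_swap hf.lintegral_prod_right'.aemeasurable
    _ = ∫⁻ z, ENNReal.ofReal (ρ z) * gagliardo N s v := by
        refine lintegral_congr fun z => ?_
        simp_rw [f, lintegral_const_mul' _ _ ENNReal.ofReal_ne_top]
        rw [← gagliardo_comp_sub_right v z, gagliardo]
    _ = gagliardo N s v := by
        rw [lintegral_mul_const _ (by fun_prop), hρ1, one_mul]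

/-- A linear bound of `∫_Ω |u| / d_Ω^s` passes to almost everywhere limits. -/
theorem mul_hardyIntegral_le_of_tendsto {c : ℝ≥0} {u : ℕ → EuclideanSpace ℝ (Fin N) → ℝ}
    {v : EuclideanSpace ℝ (Fin N) → ℝ} (hu : ∀ n, Measurable (u n))
    (hlim : ∀ᵐ x, Tendsto (fun n => u n x) atTop (𝓝 (v x))) {B : ℕ → ℝ≥0∞} {b : ℝ≥0∞}
    (hB : Tendsto B atTop (𝓝 b)) (hle : ∀ n, c * hardyIntegral N s Ω (u n) ≤ B n) :
    c * hardyIntegral N s Ω v ≤ b := by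
  have hc : ∀ w : EuclideanSpace ℝ (Fin N) → ℝ,
      c * hardyIntegral N s Ω w = hardyIntegral N s Ω fun x => (c : ℝ) * w x := by
    intro w
    rw [hardyIntegral_const_mul, NNReal.abs_eq, ENNReal.ofReal_coe_nnreal]
  simp_rw [hc] at hle ⊢
  calc hardyIntegral N s Ω (fun x => (c : ℝ) * v x)
      = ∫⁻ x in Ω, liminf (fun n => ENNReal.ofReal (|(c : ℝ) * u n x| / bdryDist Ω x ^ s))
          atTop := by
        refine lintegral_congr_ae (ae_restrict_of_ae ?_)
        filter_upwards [hlim] with x hx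
        refine Tendsto.liminf_eq ?_ |>.symm
        exact ENNReal.tendsto_ofReal (((hx.const_mul _).abs).div_const _)
    _ ≤ liminf (fun n => hardyIntegral N s Ω fun x => (c : ℝ) * u n x) atTop := by
        refine lintegral_liminf_le fun n => ?_
        have := hu n
        fun_prop
    _ ≤ liminf B atTop := liminf_le_liminf (.of_forall hle)
    _ = b := hB.liminf_eq

theorem mul_hardyIntegral_le_gagliardo_of_hasCompactSupport (hop : IsOpen Ω) (hproper : Ω ≠ univ)
    {c : ℝ≥0} (hc : (c : ℝ≥0∞) ≤ hardyConst N s Ω) {v : EuclideanSpace ℝ (Fin N) → ℝ}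
    (hv : Measurable v) (hint : Integrable v) (hcs : HasCompactSupport v)
    (hsub : tsupport v ⊆ Ω) : c * hardyIntegral N s Ω v ≤ gagliardo N s v := by
  obtain ⟨δ, hδ, hδΩ⟩ := hcs.isCompact.exists_cthickening_subset_open hop hsub
  let φ : ℕ → ContDiffBump (0 : EuclideanSpace ℝ (Fin N)) := fun n =>
    { rIn := δ / (n + 1) / 2
      rOut := δ / (n + 1)
      rIn_pos := by positivity
      rIn_lt_rOut := half_lt_self (by positivity) }
  let u : ℕ → EuclideanSpace ℝ (Fin N) → ℝ := fun n =>
    (φ n).normed volume ⋆[ContinuousLinearMap.lsmul ℝ ℝ, volume] v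
  have hsmooth : ∀ n, ContDiff ℝ (⊤ : ℕ∞) (u n) := fun n =>
    (φ n).hasCompactSupport_normed.contDiff_convolution_left _ (φ n).contDiff_normed
      hint.locallyIntegrable
  have hsupp : ∀ n, Function.support (u n) ⊆ Metric.cthickening δ (tsupport v) := by
    intro n x hx
    obtain ⟨a, ha, b, hb, rfl⟩ := support_convolution_subset_swap _ hx
    rw [(φ n).support_normed_eq, mem_ball_zero_iff] at hb
    refine Metric.mem_cthickening_of_dist_le _ a _ _ (subset_tsupport v ha) ?_
    rw [dist_eq_norm, add_sub_cancel_left]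
    refine hb.le.trans (div_le_self hδ.le ?_)
    linarith [Nat.cast_nonneg (α := ℝ) n]
  have hcomp : IsCompact (Metric.cthickening δ (tsupport v)) := hcs.isCompact.cthickening
  have hrOut : Tendsto (fun n => (φ n).rOut) atTop (𝓝 0) := by
    simpa [φ, div_eq_mul_inv] using
      (tendsto_one_div_add_atTop_nhds_zero_nat (𝕜 := ℝ)).const_mul δ
  refine mul_hardyIntegral_le_of_tendsto (u := u) (fun n => (hsmooth n).continuous.measurable)
    (ContDiffBump.ae_convolution_tendsto_right_of_locallyIntegrable (K := 2) hrOut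
      (.of_forall fun n => ?_) hint.locallyIntegrable) tendsto_const_nhds (fun n => ?_)
  · simp only [φ]; linarith
  · have h1 : hardyConst N s Ω * hardyIntegral N s Ω (u n) ≤ gagliardo N s (u n) :=
      hardyConst_mul_hardyIntegral_le hop hproper (hsmooth n)
        (.of_support_subset_isCompact hcomp (hsupp n))
        ((closure_minimal (hsupp n) Metric.isClosed_cthickening).trans hδΩ)
    refine (mul_le_mul_left hc _).trans (h1.trans ?_)
    refine gagliardo_convolution_le (φ n).continuous_normed.measurable (φ n).nonneg_normed ?_ hv ?_
    · rw [← ofReal_integral_eq_lintegral_ofReal (φ n).integrable_normed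
        (.of_forall (φ n).nonneg_normed), (φ n).integral_normed, ENNReal.ofReal_one]
    · exact (φ n).hasCompactSupport_normed.convolutionExists_left _ (φ n).continuous_normed
        hint.locallyIntegrable

end Mollification

section Main

variable {N : ℕ} {s : ℝ} {Ω : Set (EuclideanSpace ℝ (Fin N))}

theorem hardyIntegral_indicator {E : Set (EuclideanSpace ℝ (Fin N))} (hE : MeasurableSet E)
    (hEΩ : E ⊆ Ω) :
    hardyIntegral N s Ω (E.indicator fun _ => (1 : ℝ)) = weightedVol N s Ω E := by
  have h : (fun x => ENNReal.ofReal (|E.indicator (fun _ => (1 : ℝ)) x| / bdryDist Ω x ^ s)) =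
      E.indicator fun x => ENNReal.ofReal (bdryDist Ω x ^ (-s)) := by
    ext x
    by_cases hx : x ∈ E
    · have hd : 0 ≤ bdryDist Ω x := Metric.infDist_nonneg
      simp [hx, Real.rpow_neg hd]
    · simp [hx]
  rw [hardyIntegral, h, lintegral_indicator hE, Measure.restrict_restrict hE,
    inter_eq_left.2 hEΩ, weightedVol]

theorem hardyConst_le_cheegerConst (hN : 1 ≤ N) (hs : s ∈ Ioo (0 : ℝ) 1) (hop : IsOpen Ω)
    (hproper : Ω ≠ univ) : hardyConst N s Ω ≤ cheegerConst N s Ω := by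
  refine le_sInf ?_
  rintro _ ⟨E, hEΩ, hE, hpos, hfin, rfl⟩
  rcases eq_or_ne (fracPerimeter N s E) ∞ with hP | hP
  · rw [hP, ENNReal.top_div_of_lt_top hfin]
    exact le_top
  have hVpos := weightedVol_pos (s := s) hop hproper hEΩ hpos
  refine ENNReal.le_of_forall_nnreal_lt fun c hc => ?_
  rw [ENNReal.le_div_iff_mul_le (Or.inl hVpos.ne') (Or.inl hfin.ne),
    ← hardyIntegral_indicator hE hEΩ]
  obtain ⟨x₀, hx₀⟩ := nonempty_compl.2 hproper
  have hu : Measurable (E.indicator fun _ => (1 : ℝ)) := measurable_const.indicator hE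
  have hsupp : ∀ x ∉ Ω, E.indicator (fun _ => (1 : ℝ)) x = 0 := fun x hx =>
    indicator_of_notMem (fun h => hx (hEΩ h)) _
  refine mul_hardyIntegral_le_of_tendsto
    (fun n => hu.mul (continuous_domainCutoff (Ω := Ω) x₀ n).measurable) (.of_forall fun x => ?_)
    (tendsto_gagliardo_mul_domainCutoff hN hs hop hproper hx₀ hu hsupp hP
      (hardyIntegral_indicator hE hEΩ ▸ hfin.ne)) (fun n => ?_)
  · by_cases hx : x ∈ Ω
    · simpa using (tendsto_domainCutoff hop hproper hx).const_mul
        (E.indicator (fun _ => (1 : ℝ)) x)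
    · simp [hsupp x hx]
  · have hη := continuous_domainCutoff (Ω := Ω) x₀ n
    have hcs := hasCompactSupport_domainCutoff (Ω := Ω) x₀ n
    refine mul_hardyIntegral_le_gagliardo_of_hasCompactSupport hop hproper hc.le
      (hu.mul hη.measurable) ?_ hcs.mul_left
      ((closure_mono (Function.support_mul_subset_right _ _)).trans
        (tsupport_domainCutoff_subset x₀ n))
    refine (hη.integrable_of_hasCompactSupport hcs).mono (hu.mul hη.measurable).aestronglyMeasurable
      (.of_forall fun x => ?_)
    by_cases hx : x ∈ E <;> simp [hx]

end Main

theorem hardy_eq_cheeger (N : ℕ) (hN : 1 ≤ N) (s : ℝ) (hs : s ∈ Set.Ioo (0 : ℝ) 1)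
    (Ω : Set (EuclideanSpace ℝ (Fin N))) (hne : Ω.Nonempty) (hop : IsOpen Ω)
    (hproper : Ω ≠ Set.univ) :
    hardyConst N s Ω = cheegerConst N s Ω :=
  le_antisymm (hardyConst_le_cheegerConst hN hs hop hproper)
    (cheegerConst_le_hardyConst hop hproper)
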